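/- arXiv:math/0606524 — 6 statements merged into one kernel-verified Lean document; each statement's English description precedes it below -/
import Mathlib

section
/- Let r, f, J be complex numbers and let c ∈ {1, −1}. Assume that none of the Gamma arguments occurring in Z(r, f, J, c) and Z(r, f−1, J+1, c) is a nonpositive integer. Then Z(r, f−1, J+1, c) · (−f+J+1−r−c/2) = (−f+J+1+r+c/2) · Z(r, f, J, c), i.e. the quotient Z(r, f−1, J+1, c)/Z(r, f, J, c) equals the transition eigenvalue quotient (−f+J+1+r+c/2)/(−f+J+1−r−c/2). -/
open Complex

/-- `z` is not a nonpositive integer (i.e. not of the form `-m` for `m : ℕ`). -/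
def NotNonposInt (z : ℂ) : Prop := ∀ m : ℕ, z ≠ -(m : ℂ)

/-- The spectral function of the order-`2r` intertwinor on the multiplicity-one
`K`-types of the twistor bundle over `S¹ × S^{n-1}`. -/
noncomputable def Z (r f J c : ℂ) : ℂ :=
  (c / 2) * Complex.Gamma ((f + J + 1 + r - c / 2) / 2) *
      Complex.Gamma ((-f + J + 1 + r + c / 2) / 2) /
    (Complex.Gamma ((f + J + 1 - r + c / 2) / 2) *
      Complex.Gamma ((-f + J + 1 - r - c / 2) / 2))

theorem Z_recursion_down_up (r f J c : ℂ) (hc : c = 1 ∨ c = -1)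
    (h1 : NotNonposInt ((f + J + 1 + r - c / 2) / 2))
    (h2 : NotNonposInt ((-f + J + 1 + r + c / 2) / 2))
    (h3 : NotNonposInt ((f + J + 1 - r + c / 2) / 2))
    (h4 : NotNonposInt ((-f + J + 1 - r - c / 2) / 2))
    (h5 : NotNonposInt (((f - 1) + (J + 1) + 1 + r - c / 2) / 2))
    (h6 : NotNonposInt ((-(f - 1) + (J + 1) + 1 + r + c / 2) / 2))
    (h7 : NotNonposInt (((f - 1) + (J + 1) + 1 - r + c / 2) / 2))
    (h8 : NotNonposInt ((-(f - 1) + (J + 1) + 1 - r - c / 2) / 2)) :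
    Z r (f - 1) (J + 1) c * (-f + J + 1 - r - c / 2) =
      (-f + J + 1 + r + c / 2) * Z r f J c := by
  have ha : (-f + J + 1 + r + c / 2) / 2 ≠ 0 := by simpa using h2 0
  have hb : (-f + J + 1 - r - c / 2) / 2 ≠ 0 := by simpa using h4 0
  have g3 := Complex.Gamma_ne_zero h3
  have g4 := Complex.Gamma_ne_zero h4
  have e1 : (f - 1) + (J + 1) + 1 + r - c / 2 = f + J + 1 + r - c / 2 := by ring
  have e2 : (f - 1) + (J + 1) + 1 - r + c / 2 = f + J + 1 - r + c / 2 := by ring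
  have e3 : (-(f - 1) + (J + 1) + 1 + r + c / 2) / 2
      = (-f + J + 1 + r + c / 2) / 2 + 1 := by ring
  have e4 : (-(f - 1) + (J + 1) + 1 - r - c / 2) / 2
      = (-f + J + 1 - r - c / 2) / 2 + 1 := by ring
  unfold Z
  rw [e1, e2, e3, e4, Complex.Gamma_add_one _ ha, Complex.Gamma_add_one _ hb]
  have e5 : -f + J + 1 + r + c / 2 = 2 * ((-f + J + 1 + r + c / 2) / 2) := by ring
  have e6 : -f + J + 1 - r - c / 2 = 2 * ((-f + J + 1 - r - c / 2) / 2) := by ring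
  generalize Complex.Gamma ((f + J + 1 + r - c / 2) / 2) = G1
  generalize Complex.Gamma ((f + J + 1 - r + c / 2) / 2) = G3 at *
  generalize Complex.Gamma ((-f + J + 1 + r + c / 2) / 2) = G2
  generalize Complex.Gamma ((-f + J + 1 - r - c / 2) / 2) = G4 at *
  generalize (-f + J + 1 + r + c / 2) / 2 = a at *
  generalize (-f + J + 1 - r - c / 2) / 2 = b at *
  rw [e5, e6]
  field_simp
end

section
/- Let r, f, J be complex numbers and let c ∈ {1, −1}. Assume that none of the Gamma arguments occurring in Z(r, f, J, c) and Z(r, f+1, J−1, c) is a nonpositive integer. Then Z(r, f+1, J−1, c) · (f−J+1−r−c/2) = (f−J+1+r+c/2) · Z(r, f, J, c), i.e. the quotient Z(r, f+1, J−1, c)/Z(r, f, J, c) equals the transition eigenvalue quotient (f−J+1+r+c/2)/(f−J+1−r−c/2). -/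
open Complex

theorem Z_recursion_up_down (r f J c : ℂ) (hc : c = 1 ∨ c = -1)
    (h1 : NotNonposInt ((f + J + 1 + r - c / 2) / 2))
    (h2 : NotNonposInt ((-f + J + 1 + r + c / 2) / 2))
    (h3 : NotNonposInt ((f + J + 1 - r + c / 2) / 2))
    (h4 : NotNonposInt ((-f + J + 1 - r - c / 2) / 2))
    (h5 : NotNonposInt (((f + 1) + (J - 1) + 1 + r - c / 2) / 2))
    (h6 : NotNonposInt ((-(f + 1) + (J - 1) + 1 + r + c / 2) / 2))
    (h7 : NotNonposInt (((f + 1) + (J - 1) + 1 - r + c / 2) / 2))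
    (h8 : NotNonposInt ((-(f + 1) + (J - 1) + 1 - r - c / 2) / 2)) :
    Z r (f + 1) (J - 1) c * (f - J + 1 - r - c / 2) =
      (f - J + 1 + r + c / 2) * Z r f J c := by
  have hb : (-(f + 1) + (J - 1) + 1 + r + c / 2) / 2 ≠ 0 := by simpa using h6 0
  have hd : (-(f + 1) + (J - 1) + 1 - r - c / 2) / 2 ≠ 0 := by simpa using h8 0
  have hG3 := Complex.Gamma_ne_zero h3
  have hG8 := Complex.Gamma_ne_zero h8
  have e1 : (f + 1) + (J - 1) + 1 + r - c / 2 = f + J + 1 + r - c / 2 := by ring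
  have e3 : (f + 1) + (J - 1) + 1 - r + c / 2 = f + J + 1 - r + c / 2 := by ring
  have e2 : (-f + J + 1 + r + c / 2) / 2
      = (-(f + 1) + (J - 1) + 1 + r + c / 2) / 2 + 1 := by ring
  have e4 : (-f + J + 1 - r - c / 2) / 2
      = (-(f + 1) + (J - 1) + 1 - r - c / 2) / 2 + 1 := by ring
  have e5 : f - J + 1 - r - c / 2
      = -2 * ((-(f + 1) + (J - 1) + 1 + r + c / 2) / 2) := by ring
  have e6 : f - J + 1 + r + c / 2
      = -2 * ((-(f + 1) + (J - 1) + 1 - r - c / 2) / 2) := by ring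
  unfold Z
  rw [e1, e3, e2, e4, e5, e6, Complex.Gamma_add_one _ hb, Complex.Gamma_add_one _ hd]
  generalize (-(f + 1) + (J - 1) + 1 + r + c / 2) / 2 = b at *
  generalize (-(f + 1) + (J - 1) + 1 - r - c / 2) / 2 = d at *
  generalize Complex.Gamma ((f + J + 1 - r + c / 2) / 2) = G3 at *
  generalize Complex.Gamma d = G8 at *
  field_simp
end

section
/- Let r, f, J be complex numbers and let c ∈ {1, −1}. Assume that none of the Gamma arguments occurring in Z(r, f, J, c) and Z(r, f−1, J−1, c) is a nonpositive integer. Then Z(r, f−1, J−1, c) · (−f−J+1−r+c/2) = (−f−J+1+r−c/2) · Z(r, f, J, c), i.e. the quotient Z(r, f−1, J−1, c)/Z(r, f, J, c) equals the transition eigenvalue quotient (−f−J+1+r−c/2)/(−f−J+1−r+c/2). -/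
open Complex

theorem Z_recursion_down_down (r f J c : ℂ) (hc : c = 1 ∨ c = -1)
    (h1 : NotNonposInt ((f + J + 1 + r - c / 2) / 2))
    (h2 : NotNonposInt ((-f + J + 1 + r + c / 2) / 2))
    (h3 : NotNonposInt ((f + J + 1 - r + c / 2) / 2))
    (h4 : NotNonposInt ((-f + J + 1 - r - c / 2) / 2))
    (h5 : NotNonposInt (((f - 1) + (J - 1) + 1 + r - c / 2) / 2))
    (h6 : NotNonposInt ((-(f - 1) + (J - 1) + 1 + r + c / 2) / 2))
    (h7 : NotNonposInt (((f - 1) + (J - 1) + 1 - r + c / 2) / 2))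
    (h8 : NotNonposInt ((-(f - 1) + (J - 1) + 1 - r - c / 2) / 2)) :
    Z r (f - 1) (J - 1) c * (-f - J + 1 - r + c / 2) =
      (-f - J + 1 + r - c / 2) * Z r f J c := by
  have e1 : ((f - 1) + (J - 1) + 1 + r - c / 2) / 2 + 1 = (f + J + 1 + r - c / 2) / 2 := by ring
  have e3 : ((f - 1) + (J - 1) + 1 - r + c / 2) / 2 + 1 = (f + J + 1 - r + c / 2) / 2 := by ring
  have e2 : (-(f - 1) + (J - 1) + 1 + r + c / 2) / 2 = (-f + J + 1 + r + c / 2) / 2 := by ring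
  have e4 : (-(f - 1) + (J - 1) + 1 - r - c / 2) / 2 = (-f + J + 1 - r - c / 2) / 2 := by ring
  have n5 : ((f - 1) + (J - 1) + 1 + r - c / 2) / 2 ≠ 0 := by simpa using h5 0
  have n7 : ((f - 1) + (J - 1) + 1 - r + c / 2) / 2 ≠ 0 := by simpa using h7 0
  have g7 := Complex.Gamma_ne_zero h7
  have g4 := Complex.Gamma_ne_zero h4
  have k1 : -f - J + 1 - r + c / 2 = -2 * (((f - 1) + (J - 1) + 1 + r - c / 2) / 2) := by ring
  have k2 : -f - J + 1 + r - c / 2 = -2 * (((f - 1) + (J - 1) + 1 - r + c / 2) / 2) := by ring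
  unfold Z
  rw [k1, k2, e2, e4, ← e1, ← e3, Complex.Gamma_add_one _ n5, Complex.Gamma_add_one _ n7]
  clear k1 k2 e1 e2 e3 e4
  generalize ((f - 1) + (J - 1) + 1 + r - c / 2) / 2 = a at *
  generalize ((f - 1) + (J - 1) + 1 - r + c / 2) / 2 = b at *
  generalize Complex.Gamma b = gb at *
  generalize Complex.Gamma ((-f + J + 1 - r - c / 2) / 2) = gd at *
  field_simp
end

section
/- Let r, f, J be complex numbers and let c ∈ {1, −1}. Assume that none of the Gamma arguments occurring in G(r, f, J, c) and G(r, f+1, J−1, c) is a nonpositive integer. Then G(r, f+1, J−1, c) · (f−J−r−c/2)(f−J+2−r−c/2) = (f−J+r+c/2)(f−J+2+r+c/2) · G(r, f, J, c); equivalently, for Ξ ∈ {1, −1} the quotient G(r, f+1, J−1, c)/G(r, f, J, c) equals the determinant quotient ((f−J+1−Ξ+r+c/2)(f−J+1+Ξ+r+c/2)) / ((f−J+1−Ξ−r−c/2)(f−J+1+Ξ−r−c/2)). -/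
open Complex

/-- The determinant spectral function of the order-`2r` intertwinor on the
multiplicity-two `K`-types of the twistor bundle over `S¹ × S^{n-1}`. -/
noncomputable def G (r f J c : ℂ) : ℂ :=
  (1 / 4) * (Complex.Gamma ((f + J + r - c / 2) / 2) *
      Complex.Gamma ((-f + J + r + c / 2) / 2) *
      Complex.Gamma ((f + J + 2 + r - c / 2) / 2) *
      Complex.Gamma ((-f + J + 2 + r + c / 2) / 2)) /
    (Complex.Gamma ((f + J - r + c / 2) / 2) *
      Complex.Gamma ((-f + J - r - c / 2) / 2) *
      Complex.Gamma ((f + J + 2 - r + c / 2) / 2) *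
      Complex.Gamma ((-f + J + 2 - r - c / 2) / 2))

theorem G_recursion_up_down (r f J c : ℂ) (hc : c = 1 ∨ c = -1)
    (h1  : NotNonposInt ((f + J + r - c / 2) / 2))
    (h2 : NotNonposInt ((-(f) + J + r + c / 2) / 2))
    (h3 : NotNonposInt ((f + J + 2 + r - c / 2) / 2))
    (h4 : NotNonposInt ((-(f) + J + 2 + r + c / 2) / 2))
    (h5 : NotNonposInt ((f + J - r + c / 2) / 2))
    (h6 : NotNonposInt ((-(f) + J - r - c / 2) / 2))
    (h7 : NotNonposInt ((f + J + 2 - r + c / 2) / 2))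
    (h8 : NotNonposInt ((-(f) + J + 2 - r - c / 2) / 2))
    (h9  : NotNonposInt ((f + 1 + J - 1 + r - c / 2) / 2))
    (h10 : NotNonposInt ((-(f + 1) + J - 1 + r + c / 2) / 2))
    (h11 : NotNonposInt ((f + 1 + J - 1 + 2 + r - c / 2) / 2))
    (h12 : NotNonposInt ((-(f + 1) + J - 1 + 2 + r + c / 2) / 2))
    (h13 : NotNonposInt ((f + 1 + J - 1 - r + c / 2) / 2))
    (h14 : NotNonposInt ((-(f + 1) + J - 1 - r - c / 2) / 2))
    (h15 : NotNonposInt ((f + 1 + J - 1 + 2 - r + c / 2) / 2))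
    (h16 : NotNonposInt ((-(f + 1) + J - 1 + 2 - r - c / 2) / 2)) :
    G r (f + 1) (J - 1) c * ((f - J - r - c / 2) * (f - J + 2 - r - c / 2)) = ((f - J + r + c / 2) * (f - J + 2 + r + c / 2)) * G r f J c := by
  have key : ∀ a b P Q R S : ℂ, a ≠ 0 → a + 1 ≠ 0 → b ≠ 0 → b + 1 ≠ 0 →
      (1 / 4) * (P * Gamma a * Q * Gamma (a + 1)) / (R * Gamma b * S * Gamma (b + 1)) *
        (a * (a + 1)) = (b * (b + 1)) *
      ((1 / 4) * (P * Gamma (a + 1) * Q * Gamma (a + 1 + 1)) /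
        (R * Gamma (b + 1) * S * Gamma (b + 1 + 1))) := by
    intro a b P Q R S ha ha1 hb hb1
    rw [Gamma_add_one _ ha1, Gamma_add_one _ hb1, Gamma_add_one _ ha, Gamma_add_one _ hb]
    have e : R * (b * Gamma b) * S * ((b + 1) * (b * Gamma b)) =
      (b * (b + 1)) * (R * Gamma b * S * (b * Gamma b)) := by ring
    rw [e, ← mul_div_assoc, mul_div_mul_left _ _ (mul_ne_zero hb hb1)]
    ring
  have n10 := h10 0
  have n12 := h12 0
  have n14 := h14 0
  have n16 := h16 0
  simp only [Nat.cast_zero, neg_zero] at n10 n12 n14 n16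
  have E1 : (-(f + 1) + J - 1 + 2 + r + c / 2) / 2
      = (-(f + 1) + J - 1 + r + c / 2) / 2 + 1 := by ring
  have E2 : (-(f + 1) + J - 1 + 2 - r - c / 2) / 2
      = (-(f + 1) + J - 1 - r - c / 2) / 2 + 1 := by ring
  rw [E1] at n12
  rw [E2] at n16
  have k := key _ _ (Gamma ((f + J + r - c / 2) / 2)) (Gamma ((f + J + 2 + r - c / 2) / 2))
    (Gamma ((f + J - r + c / 2) / 2)) (Gamma ((f + J + 2 - r + c / 2) / 2)) n10 n12 n14 n16
  have g1 : G r (f + 1) (J - 1) c = (1 / 4) * (Gamma ((f + J + r - c / 2) / 2) *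
      Gamma ((-(f + 1) + J - 1 + r + c / 2) / 2) * Gamma ((f + J + 2 + r - c / 2) / 2) *
      Gamma ((-(f + 1) + J - 1 + r + c / 2) / 2 + 1)) / (Gamma ((f + J - r + c / 2) / 2) *
      Gamma ((-(f + 1) + J - 1 - r - c / 2) / 2) * Gamma ((f + J + 2 - r + c / 2) / 2) *
      Gamma ((-(f + 1) + J - 1 - r - c / 2) / 2 + 1)) := by
    unfold G
    have q0 : ((f + 1) + (J - 1) + r - c / 2) / 2 = (f + J + r - c / 2) / 2 := by ring
    have q1 : (-(f + 1) + (J - 1) + r + c / 2) / 2 = (-(f + 1) + J - 1 + r + c / 2) / 2 := by ring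
    have q2 : ((f + 1) + (J - 1) + 2 + r - c / 2) / 2 = (f + J + 2 + r - c / 2) / 2 := by ring
    have q3 : (-(f + 1) + (J - 1) + 2 + r + c / 2) / 2 = (-(f + 1) + J - 1 + r + c / 2) / 2 + 1 := by ring
    have q4 : ((f + 1) + (J - 1) - r + c / 2) / 2 = (f + J - r + c / 2) / 2 := by ring
    have q5 : (-(f + 1) + (J - 1) - r - c / 2) / 2 = (-(f + 1) + J - 1 - r - c / 2) / 2 := by ring
    have q6 : ((f + 1) + (J - 1) + 2 - r + c / 2) / 2 = (f + J + 2 - r + c / 2) / 2 := by ring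
    have q7 : (-(f + 1) + (J - 1) + 2 - r - c / 2) / 2 = (-(f + 1) + J - 1 - r - c / 2) / 2 + 1 := by ring
    rw [q0, q1, q2, q3, q4, q5, q6, q7]
  have g2 : G r f J c = (1 / 4) * (Gamma ((f + J + r - c / 2) / 2) *
      Gamma ((-(f + 1) + J - 1 + r + c / 2) / 2 + 1) * Gamma ((f + J + 2 + r - c / 2) / 2) *
      Gamma ((-(f + 1) + J - 1 + r + c / 2) / 2 + 1 + 1)) / (Gamma ((f + J - r + c / 2) / 2) *
      Gamma ((-(f + 1) + J - 1 - r - c / 2) / 2 + 1) * Gamma ((f + J + 2 - r + c / 2) / 2) *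
      Gamma ((-(f + 1) + J - 1 - r - c / 2) / 2 + 1 + 1)) := by
    unfold G
    have q1 : (-f + J + r + c / 2) / 2 = (-(f + 1) + J - 1 + r + c / 2) / 2 + 1 := by ring
    have q3 : (-f + J + 2 + r + c / 2) / 2 = (-(f + 1) + J - 1 + r + c / 2) / 2 + 1 + 1 := by ring
    have q5 : (-f + J - r - c / 2) / 2 = (-(f + 1) + J - 1 - r - c / 2) / 2 + 1 := by ring
    have q7 : (-f + J + 2 - r - c / 2) / 2 = (-(f + 1) + J - 1 - r - c / 2) / 2 + 1 + 1 := by ring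
    rw [q1, q3, q5, q7]
  rw [← g1, ← g2] at k
  linear_combination 4 * k
end

section
/- Let r, f, J be complex numbers and let c ∈ {1, −1}. Assume that none of the Gamma arguments occurring in G(r, f, J, c) and G(r, f−1, J−1, c) is a nonpositive integer. Then G(r, f−1, J−1, c) · (−f−J−r+c/2)(−f−J+2−r+c/2) = (−f−J+r−c/2)(−f−J+2+r−c/2) · G(r, f, J, c); equivalently, for Ξ ∈ {1, −1} the quotient G(r, f−1, J−1, c)/G(r, f, J, c) equals the determinant quotient ((−f−J+1−Ξ+r−c/2)(−f−J+1+Ξ+r−c/2)) / ((−f−J+1−Ξ−r+c/2)(−f−J+1+Ξ−r+c/2)). -/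
open Complex

theorem G_recursion_down_down (r f J c : ℂ) (hc : c = 1 ∨ c = -1)
    (h1  : NotNonposInt ((f + J + r - c / 2) / 2))
    (h2 : NotNonposInt ((-(f) + J + r + c / 2) / 2))
    (h3 : NotNonposInt ((f + J + 2 + r - c / 2) / 2))
    (h4 : NotNonposInt ((-(f) + J + 2 + r + c / 2) / 2))
    (h5 : NotNonposInt ((f + J - r + c / 2) / 2))
    (h6 : NotNonposInt ((-(f) + J - r - c / 2) / 2))
    (h7 : NotNonposInt ((f + J + 2 - r + c / 2) / 2))
    (h8 : NotNonposInt ((-(f) + J + 2 - r - c / 2) / 2))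
    (h9  : NotNonposInt ((f - 1 + J - 1 + r - c / 2) / 2))
    (h10 : NotNonposInt ((-(f - 1) + J - 1 + r + c / 2) / 2))
    (h11 : NotNonposInt ((f - 1 + J - 1 + 2 + r - c / 2) / 2))
    (h12 : NotNonposInt ((-(f - 1) + J - 1 + 2 + r + c / 2) / 2))
    (h13 : NotNonposInt ((f - 1 + J - 1 - r + c / 2) / 2))
    (h14 : NotNonposInt ((-(f - 1) + J - 1 - r - c / 2) / 2))
    (h15 : NotNonposInt ((f - 1 + J - 1 + 2 - r + c / 2) / 2))
    (h16 : NotNonposInt ((-(f - 1) + J - 1 + 2 - r - c / 2) / 2)) :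
    G r (f - 1) (J - 1) c * ((-f - J - r + c / 2) * (-f - J + 2 - r + c / 2)) = ((-f - J + r - c / 2) * (-f - J + 2 + r - c / 2)) * G r f J c := by
  obtain ⟨A, hA⟩ : ∃ A, A = (f - 1 + J - 1 + r - c / 2) / 2 := ⟨_, rfl⟩
  obtain ⟨D, hD⟩ : ∃ D, D = (f - 1 + J - 1 - r + c / 2) / 2 := ⟨_, rfl⟩
  obtain ⟨B, hB⟩ : ∃ B, B = (-f + J + r + c / 2) / 2 := ⟨_, rfl⟩
  obtain ⟨E, hE⟩ : ∃ E, E = (-f + J - r - c / 2) / 2 := ⟨_, rfl⟩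
  have eA : (f + J + r - c / 2) / 2 = A + 1 := by rw [hA]; ring
  have eA2 : (f + J + 2 + r - c / 2) / 2 = A + 1 + 1 := by rw [hA]; ring
  have eA' : (f - 1 + (J - 1) + r - c / 2) / 2 = A := by rw [hA]; ring
  have eA2' : (f - 1 + (J - 1) + 2 + r - c / 2) / 2 = A + 1 := by rw [hA]; ring
  have eD : (f + J - r + c / 2) / 2 = D + 1 := by rw [hD]; ring
  have eD2 : (f + J + 2 - r + c / 2) / 2 = D + 1 + 1 := by rw [hD]; ring
  have eD' : (f - 1 + (J - 1) - r + c / 2) / 2 = D := by rw [hD]; ring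
  have eD2' : (f - 1 + (J - 1) + 2 - r + c / 2) / 2 = D + 1 := by rw [hD]; ring
  have eB' : (-(f - 1) + (J - 1) + r + c / 2) / 2 = B := by rw [hB]; ring
  have eB2 : (-f + J + 2 + r + c / 2) / 2 = B + 1 := by rw [hB]; ring
  have eB2' : (-(f - 1) + (J - 1) + 2 + r + c / 2) / 2 = B + 1 := by rw [hB]; ring
  have eE' : (-(f - 1) + (J - 1) - r - c / 2) / 2 = E := by rw [hE]; ring
  have eE2 : (-f + J + 2 - r - c / 2) / 2 = E + 1 := by rw [hE]; ring
  have eE2' : (-(f - 1) + (J - 1) + 2 - r - c / 2) / 2 = E + 1 := by rw [hE]; ring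
  have q1 : -f - J - r + c / 2 = -2 * (A + 1) := by rw [hA]; ring
  have q2 : -f - J + 2 - r + c / 2 = -2 * A := by rw [hA]; ring
  have q3 : -f - J + r - c / 2 = -2 * (D + 1) := by rw [hD]; ring
  have q4 : -f - J + 2 + r - c / 2 = -2 * D := by rw [hD]; ring
  rw [eA] at h1
  rw [eD] at h5
  rw [← hA] at h9
  rw [← hD] at h13
  rw [← hE] at h6
  rw [eE2] at h8
  have A0 : A ≠ 0 := by simpa using h9 0
  have A1 : A + 1 ≠ 0 := by simpa using h1 0
  have D0 : D ≠ 0 := by simpa using h13 0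
  have D1 : D + 1 ≠ 0 := by simpa using h5 0
  have gD : Complex.Gamma D ≠ 0 := Complex.Gamma_ne_zero h13
  have gE : Complex.Gamma E ≠ 0 := Complex.Gamma_ne_zero h6
  have gE1 : Complex.Gamma (E + 1) ≠ 0 := Complex.Gamma_ne_zero h8
  unfold G
  rw [eA, eA2, eA', eA2', eD, eD2, eD', eD2', eB', eB2, eB2', eE', eE2, eE2', ← hB, ← hE,
    q1, q2, q3, q4, Complex.Gamma_add_one _ A1, Complex.Gamma_add_one _ A0,
    Complex.Gamma_add_one _ D1, Complex.Gamma_add_one _ D0]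
  field_simp
end

section
/- Let r, f, J be complex numbers and let c ∈ {1, −1}. Assume that none of the Gamma arguments occurring in G(r, f, J, c) is a nonpositive integer. Then at r = 1/2 the determinant spectral function has the closed form G(1/2, f, J, c) = ((f − cJ)² − 1)/16. -/
open Complex

theorem G_at_half (r f J c : ℂ) (hc : c = 1 ∨ c = -1) (hr : r = 1 / 2)
    (h1 : NotNonposInt ((f + J + r - c / 2) / 2))
    (h2 : NotNonposInt ((-f + J + r + c / 2) / 2))
    (h3 : NotNonposInt ((f + J + 2 + r - c / 2) / 2))
    (h4 : NotNonposInt ((-f + J + 2 + r + c / 2) / 2))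
    (h5 : NotNonposInt ((f + J - r + c / 2) / 2))
    (h6 : NotNonposInt ((-f + J - r - c / 2) / 2))
    (h7 : NotNonposInt ((f + J + 2 - r + c / 2) / 2))
    (h8 : NotNonposInt ((-f + J + 2 - r - c / 2) / 2)) :
    G r f J c = ((f - c * J) ^ 2 - 1) / 16 := by
  subst hr
  have key : ∀ x y : ℂ, NotNonposInt x → NotNonposInt (x + 1) → NotNonposInt y →
      NotNonposInt (y + 1) →
      (1 / 4) * (Complex.Gamma y * Complex.Gamma (x + 1) * Complex.Gamma (y + 1) *
        Complex.Gamma (x + 1 + 1)) /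
      (Complex.Gamma y * Complex.Gamma x * Complex.Gamma (y + 1) * Complex.Gamma (x + 1))
        = x * (x + 1) / 4 := by
    intro x y hx hx1 hy hy1
    have gx := Complex.Gamma_ne_zero hx
    have gx1 := Complex.Gamma_ne_zero hx1
    have gy := Complex.Gamma_ne_zero hy
    have gy1 := Complex.Gamma_ne_zero hy1
    have x0 : x ≠ 0 := by simpa using hx 0
    have x10 : x + 1 ≠ 0 := by simpa using hx1 0
    rw [div_eq_iff (by positivity), Complex.Gamma_add_one (x + 1) x10]
    have e := Complex.Gamma_add_one x x0
    linear_combination (1 / 4) * (x + 1) * Complex.Gamma y * Complex.Gamma (x + 1) *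
      Complex.Gamma (y + 1) * e
  unfold G
  rcases hc with rfl | rfl
  · have k := key ((-f + J - 1 / 2 - 1 / 2) / 2) ((f + J - 1 / 2 + 1 / 2) / 2) h6
      (by convert h8 using 1; ring) h5 (by convert h7 using 1; ring)
    convert k using 1
    · ring_nf
    · ring
  · have k := key ((f + J - 1 / 2 + -1 / 2) / 2) ((-f + J - 1 / 2 - -1 / 2) / 2) h5
      (by convert h7 using 1; ring) h6 (by convert h8 using 1; ring)
    convert k using 1
    · ring_nf
    · ring
end
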